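/- Let d ≥ 2 and h ≥ 1. Define Φ_2(h) = h + 2 and, for d ≥ 3, Φ_d(h) = d↑^{d²−d−2}(d^{max{2,h}}). Then for every homogeneous form F ∈ R of degree d with str(F) ≥ Φ_d(h), the ideal of R generated by the partial derivatives ∂F/∂x_1, …, ∂F/∂x_N is not contained in any ideal of R generated by h homogeneous forms of degrees at most d−1. -/

import Mathlib

open MvPolynomial

/-- Knuth's up-arrow `knuth a k b = a ↑^k b`, with `a ↑^1 b = a ^ b`,
`a ↑^(k+1) 1 = a` and `a ↑^(k+1) (b+1) = a ↑^k (a ↑^(k+1) b)`. -/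
def knuth (a : ℕ) : ℕ → ℕ → ℕ
  | 0, b => a ^ b
  | 1, b => a ^ b
  | _+2, 0 => 1
  | _+2, 1 => a
  | k+2, b+2 => knuth a (k+1) (knuth a (k+2) (b+1))
  termination_by k b => (k, b)

/-- `F` has a `k`-collapse: `F = Σ_{i=1}^k f_i g_i` with all `f_i, g_i`
homogeneous of positive degree.  The strength of `F` is `≥ k` iff `F` has no
`k`-collapse. -/
def HasCollapse {K : Type*} [CommSemiring K] {N : ℕ} (k : ℕ)
    (F : MvPolynomial (Fin N) K) : Prop :=
  ∃ f g : Fin k → MvPolynomial (Fin N) K,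
    (∀ i, ∃ d > 0, (f i).IsHomogeneous d) ∧
    (∀ i, ∃ d > 0, (g i).IsHomogeneous d) ∧
    F = ∑ i, f i * g i

lemma lt_knuth {a : ℕ} (ha : 2 ≤ a) (k b : ℕ) : b < knuth a k b := by
  induction k, b using knuth.induct (a := a) with
  | case1 b => rw [knuth]; exact Nat.lt_pow_self ha
  | case2 b => rw [knuth]; exact Nat.lt_pow_self ha
  | case3 k => rw [knuth]; exact Nat.one_pos
  | case4 k => rw [knuth]; omega
  | case5 k b ih₁ ih₂ => rw [knuth]; omega

lemma one_add_mul_le_pow_max {d : ℕ} (hd : 2 ≤ d) (h : ℕ) : 1 + (d - 1) * h ≤ d ^ max 2 h := by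
  obtain ⟨e, rfl⟩ : ∃ e, d = e + 1 := ⟨d - 1, by omega⟩
  have key (n : ℕ) : 1 + e * n ≤ (e + 1) ^ n := by
    induction n with
    | zero => simp
    | succ n ih => rw [pow_succ]; nlinarith [Nat.zero_le (e * n * e)]
  calc 1 + (e + 1 - 1) * h ≤ 1 + e * max 2 h := by
        simp only [Nat.add_sub_cancel]
        gcongr
        exact le_max_right 2 h
    _ ≤ _ := key _

namespace HasCollapse

variable {K : Type*} [CommSemiring K] {N : ℕ}

lemma zero : HasCollapse 0 (0 : MvPolynomial (Fin N) K) :=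
  ⟨Fin.elim0, Fin.elim0, fun i ↦ i.elim0, fun i ↦ i.elim0, by simp⟩

lemma mul {f g : MvPolynomial (Fin N) K} {a b : ℕ} (ha : 0 < a) (hb : 0 < b)
    (hf : f.IsHomogeneous a) (hg : g.IsHomogeneous b) : HasCollapse 1 (f * g) :=
  ⟨fun _ ↦ f, fun _ ↦ g, fun _ ↦ ⟨a, ha, hf⟩, fun _ ↦ ⟨b, hb, hg⟩, by simp⟩

lemma add {k l : ℕ} {F G : MvPolynomial (Fin N) K} (hF : HasCollapse k F)
    (hG : HasCollapse l G) : HasCollapse (k + l) (F + G) := by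
  obtain ⟨f, g, hf, hg, rfl⟩ := hF
  obtain ⟨f', g', hf', hg', rfl⟩ := hG
  refine ⟨Fin.append f f', Fin.append g g', fun i ↦ ?_, fun i ↦ ?_, ?_⟩
  · induction i using Fin.addCases <;> simp [hf, hf']
  · induction i using Fin.addCases <;> simp [hg, hg']
  · simp [Fin.sum_univ_add]

lemma sum {ι : Type*} (s : Finset ι) (F : ι → MvPolynomial (Fin N) K) (k : ℕ)
    (hF : ∀ i ∈ s, HasCollapse k (F i)) : HasCollapse (s.card * k) (∑ i ∈ s, F i) := by
  classical
  induction s using Finset.induction_on with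
  | empty => simpa using zero
  | insert a s ha ih =>
    rw [Finset.sum_insert ha, Finset.card_insert_of_notMem ha, add_mul, one_mul, add_comm _ k]
    exact (hF a (by simp)).add (ih fun i hi ↦ hF i (by simp [hi]))

lemma mono {k l : ℕ} (hkl : k ≤ l) {F : MvPolynomial (Fin N) K} (hF : HasCollapse k F) :
    HasCollapse l F := by
  obtain ⟨m, rfl⟩ := Nat.exists_eq_add_of_le hkl
  have h₁ : HasCollapse 1 (0 : MvPolynomial (Fin N) K) := by
    simpa using mul one_pos one_pos (isHomogeneous_zero (Fin N) K 1) (isHomogeneous_zero (Fin N) K 1)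
  simpa using hF.add (sum (Finset.range m) (fun _ ↦ 0) 1 fun _ _ ↦ h₁)

end HasCollapse

/-- A form of positive degree over a perfect field all of whose exponents vanish in the field
(a `p`-th power, in characteristic `p`) is the product of two forms of positive degree. -/
lemma hasCollapse_one_of_forall_cast_eq_zero {M : Type*} [Field M] [PerfectField M] {N d : ℕ}
    (hd : 0 < d) {E : MvPolynomial (Fin N) M} (hE : E.IsHomogeneous d)
    (h : ∀ m ∈ E.support, ∀ k, (m k : M) = 0) : HasCollapse 1 E := by
  have hm0 : ∀ m ∈ E.support, m.degree = d := fun m hm ↦ by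
    rw [Finsupp.degree_eq_weight_one]; exact hE (mem_support_iff.mp hm)
  obtain _ | ⟨p, hp, hpM⟩ := CharP.exists' M
  · have : E = 0 := by
      rw [← support_eq_empty, Finset.eq_empty_iff_forall_notMem]
      intro m hm
      have h0 : m = 0 := by ext k; exact_mod_cast h m hm k
      have := hm0 m hm
      simp [h0] at this
      omega
    rw [this]
    exact HasCollapse.zero.mono zero_le_one
  · have : ExpChar M p := .prime hp.out
    have : PerfectRing M p := PerfectField.toPerfectRing p
    have hdvd : ∀ m ∈ E.support, ∃ m' : Fin N →₀ ℕ, m = p • m' := fun m hm ↦ by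
      have : ∀ k, p ∣ m k := fun k ↦ (CharP.cast_eq_zero_iff M p _).mp (h m hm k)
      refine ⟨m.mapRange (· / p) (by simp), ?_⟩
      ext k
      simp [Nat.mul_div_cancel' (this k)]
    by_cases hE0 : E = 0
    · rw [hE0]; exact HasCollapse.zero.mono zero_le_one
    choose! r hr using hdvd
    obtain ⟨m, hm⟩ := Finset.nonempty_iff_ne_empty.mpr (mt support_eq_empty.mp hE0)
    have hdp : ∀ m ∈ E.support, p * (r m).degree = d := fun m hm ↦ by
      rw [← hm0 m hm]
      conv_rhs => rw [hr m hm]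
      simp
    set e := (r m).degree
    have he : p * e = d := hdp m hm
    have hp2 := hp.out.two_le
    have he0 : 0 < e := Nat.pos_of_ne_zero fun h0 ↦ by simp [h0] at he; omega
    let H : MvPolynomial (Fin N) M :=
      ∑ m ∈ E.support, monomial (r m) ((frobeniusEquiv M p).symm (coeff m E))
    have hH : H.IsHomogeneous e := IsHomogeneous.sum _ _ _ fun m' hm' ↦ by
      refine isHomogeneous_monomial _ ?_
      exact Nat.eq_of_mul_eq_mul_left hp.out.pos ((hdp m' hm').trans he.symm)
    have hEH : E = H ^ p := by
      rw [sum_pow_char p]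
      conv_lhs => rw [E.as_sum]
      refine Finset.sum_congr rfl fun m hm ↦ ?_
      rw [monomial_pow, frobeniusEquiv_symm_pow_p, ← hr m hm]
    obtain ⟨q, rfl⟩ : ∃ q, p = q + 1 := ⟨p - 1, by omega⟩
    rw [hEH, pow_succ]
    exact HasCollapse.mul (Nat.mul_pos he0 (by omega)) he0 (hH.pow q) hH

namespace MvPolynomial

variable {σ R : Type*} [CommRing R]

lemma homogeneousComponent_mul (n : ℕ) (p q : MvPolynomial σ R) :
    homogeneousComponent n (p * q) =
      ∑ x ∈ Finset.HasAntidiagonal.antidiagonal n, homogeneousComponent x.1 p * homogeneousComponent x.2 q := by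
  classical
  ext m
  rw [coeff_homogeneousComponent, coeff_sum]
  simp_rw [coeff_mul]
  rw [Finset.sum_comm]
  simp_rw [coeff_homogeneousComponent]
  split_ifs with h
  · refine Finset.sum_congr rfl fun x hx ↦ ?_
    rw [Finset.sum_eq_single (x.1.degree, x.2.degree)]
    · simp
    · rintro ⟨i, j⟩ - hij
      rw [Ne, Prod.mk.injEq] at hij
      by_cases hi : x.1.degree = i
      · rw [if_neg (c := x.2.degree = _) (fun hj ↦ hij ⟨hi.symm, hj.symm⟩), mul_zero]
      · rw [if_neg hi, zero_mul]
    · intro hx'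
      refine absurd ?_ hx'
      rw [Finset.HasAntidiagonal.mem_antidiagonal] at hx ⊢
      rw [← h, ← hx, map_add]
  · refine (Finset.sum_eq_zero fun x hx ↦ Finset.sum_eq_zero fun y hy ↦ ?_).symm
    rw [Finset.HasAntidiagonal.mem_antidiagonal] at hx hy
    beta_reduce
    by_cases h₁ : x.1.degree = y.1
    · by_cases h₂ : x.2.degree = y.2
      · exact absurd (by rw [← hx, map_add, h₁, h₂, hy]) h
      · rw [if_neg h₂, mul_zero]
    · rw [if_neg h₁, zero_mul]

lemma homogeneousComponent_translate_sub_monomial (a : σ → R) (s : σ →₀ ℕ) :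
    ∀ c : R, ∀ n ≥ s.degree, homogeneousComponent n
      (aeval (fun i ↦ C (a i) + X i) (monomial s c) - monomial s c : MvPolynomial σ R) = 0 := by
  have key (p q p' q' : MvPolynomial σ R) (k l : ℕ)
      (hp : ∀ n ≥ k, homogeneousComponent n (p' - p) = 0)
      (hq : ∀ n ≥ l, homogeneousComponent n (q' - q) = 0)
      (hph : p.IsHomogeneous k) (hqh : q.IsHomogeneous l) (n : ℕ) (hn : n ≥ k + l) :
      homogeneousComponent n (p' * q' - p * q) = 0 := by
    have : p' * q' - p * q = (p' - p) * (q' - q) + (p' - p) * q + p * (q' - q) := by ring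
    rw [this, map_add, map_add, homogeneousComponent_mul, homogeneousComponent_mul,
      homogeneousComponent_mul, ← Finset.sum_add_distrib, ← Finset.sum_add_distrib]
    refine Finset.sum_eq_zero fun x hx ↦ ?_
    rw [Finset.HasAntidiagonal.mem_antidiagonal] at hx
    rw [homogeneousComponent_of_mem (m := x.1) hph, homogeneousComponent_of_mem (m := x.2) hqh]
    by_cases h₁ : k ≤ x.1
    · rw [hp _ h₁]
      by_cases h₂ : x.1 = k
      · rw [hq _ (by omega)]; ring
      · rw [if_neg h₂]; ring
    · rw [hq _ (by omega), if_neg (by omega), if_neg (by omega)]; ring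
  have key' (s t : σ →₀ ℕ)
      (hs : ∀ c : R, ∀ n ≥ s.degree, homogeneousComponent n
        (aeval (fun i ↦ C (a i) + X i) (monomial s c) - monomial s c : MvPolynomial σ R) = 0)
      (ht : ∀ c : R, ∀ n ≥ t.degree, homogeneousComponent n
        (aeval (fun i ↦ C (a i) + X i) (monomial t c) - monomial t c : MvPolynomial σ R) = 0)
      (c : R) (n : ℕ) (hn : n ≥ (s + t).degree) : homogeneousComponent n
        (aeval (fun i ↦ C (a i) + X i) (monomial (s + t) c) - monomial (s + t) c :
          MvPolynomial σ R) = 0 := by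
    have : monomial (s + t) c = monomial s c * monomial t 1 := by simp
    rw [this, map_mul]
    exact key _ _ _ _ _ _ (hs c) (ht 1) (isHomogeneous_monomial _ rfl)
      (isHomogeneous_monomial _ rfl) n (by simpa using hn)
  induction s using Finsupp.induction_linear with
  | zero => intro c n _; simp [← C_apply, algebraMap_eq]
  | add s t hs ht => exact key' s t hs ht
  | single i e =>
    induction e with
    | zero => intro c n _; simp [← C_apply, algebraMap_eq]
    | succ e ih =>
      rw [Finsupp.single_add]
      refine key' _ _ ih fun c n hn ↦ ?_
      have h₁ : monomial (Finsupp.single i 1) c = C c * X i := by simp [X, C_mul_monomial]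
      have h₂ : C c * (C (a i) + X i) - C c * X i = C (c * a i) := by rw [C_mul]; ring
      rw [Finsupp.degree_single] at hn
      rw [h₁, map_mul, aeval_C, aeval_X, algebraMap_eq, h₂,
        homogeneousComponent_of_mem (m := n) (isHomogeneous_C _ _), if_neg (by omega)]

lemma homogeneousComponent_translate (a : σ → R) {F : MvPolynomial σ R} {d : ℕ}
    (hF : F.IsHomogeneous d) :
    homogeneousComponent d (aeval (fun i ↦ C (a i) + X i) F : MvPolynomial σ R) = F := by
  have : homogeneousComponent d
      (aeval (fun i ↦ C (a i) + X i) F - F : MvPolynomial σ R) = 0 := by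
    conv_lhs => rw [F.as_sum]
    rw [map_sum, ← Finset.sum_sub_distrib, map_sum]
    refine Finset.sum_eq_zero fun m hm ↦ homogeneousComponent_translate_sub_monomial a m _ d ?_
    rw [Finsupp.degree_eq_weight_one]
    exact (hF (mem_support_iff.mp hm)).le
  rw [map_sub, sub_eq_zero, homogeneousComponent_of_mem (m := d) hF, if_pos rfl] at this
  exact this

lemma pderiv_aeval {τ : Type*} [Fintype σ] (f : σ → MvPolynomial τ R) (k : τ)
    (p : MvPolynomial σ R) :
    pderiv k (aeval f p) = ∑ j, aeval f (pderiv j p) * pderiv k (f j) := by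
  classical
  induction p using MvPolynomial.induction_on with
  | C r => simp [algebraMap_eq]
  | add p q hp hq => simp only [map_add, hp, hq, add_mul, Finset.sum_add_distrib]
  | mul_X p i hp =>
    have (j : σ) : aeval f (pderiv j (p * X i)) * pderiv k (f j) =
        (if i = j then aeval f p * pderiv k (f j) else 0) +
          f i * (aeval f (pderiv j p) * pderiv k (f j)) := by
      rw [Derivation.leibniz, pderiv_X, Pi.single_apply]
      split_ifs <;> simp [add_mul, mul_assoc]
    simp_rw [this]
    rw [Finset.sum_add_distrib, Finset.sum_ite_eq, if_pos (Finset.mem_univ i), ← Finset.mul_sum,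
      map_mul, aeval_X, Derivation.leibniz, hp, smul_eq_mul, smul_eq_mul]

end MvPolynomial

/-- If the parametrisation `a + τ`, with coordinates `x_i`, `i ∈ I`, is tangent to order `d` to the
zero locus of all the partial derivatives of `F`, then `F` has a collapse of length
`1 + (N - #I) (d - 1)`. -/
lemma hasCollapse_of_aeval_pderiv_mem {M : Type*} [Field M] [PerfectField M] {N d : ℕ}
    (hd : 0 < d) (I : Finset (Fin N)) {F : MvPolynomial (Fin N) M} (hF : F.IsHomogeneous d)
    (a : Fin N → M) (τ : Fin N → MvPolynomial (Fin N) M)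
    (h0 : ∀ j, constantCoeff (τ j) = 0) (hI : ∀ i ∈ I, τ i = X i)
    (hv : ∀ j, ∀ k ∉ I, pderiv k (τ j) = 0)
    (hP : ∀ j, aeval (fun i ↦ C (a i) + τ i) (pderiv j F) ∈ idealOfVars (Fin N) M ^ d) :
    HasCollapse (1 + (N - I.card) * (d - 1)) F := by
  classical
  set G : MvPolynomial (Fin N) M := aeval (fun i ↦ C (a i) + X i) F with hG
  set p : MvPolynomial (Fin N) M := aeval (fun i ↦ C (a i) + τ i) F with hp
  have hcoeff (k : Fin N) (m : Fin N →₀ ℕ) (hm : m.degree < d) : coeff m (pderiv k p) = 0 := by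
    have : pderiv k p ∈ idealOfVars (Fin N) M ^ d := by
      rw [hp, pderiv_aeval]
      exact Ideal.sum_mem _ fun j _ ↦ Ideal.mul_mem_right _ _ (hP j)
    exact (mem_pow_idealOfVars_iff' _ _).mp this m hm
  have hE : HasCollapse 1 (homogeneousComponent d p) := by
    refine hasCollapse_one_of_forall_cast_eq_zero hd (homogeneousComponent_isHomogeneous d p)
      fun m hm k ↦ ?_
    rw [mem_support_iff, coeff_homogeneousComponent] at hm
    split_ifs at hm with hmd
    · by_contra hk
      have hk0 : m k ≠ 0 := fun h ↦ hk (by simp [h])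
      have hmk : m - Finsupp.single k 1 + Finsupp.single k 1 = m :=
        tsub_add_cancel_of_le (by simpa [Nat.one_le_iff_ne_zero] using hk0)
      have hdeg : (m - Finsupp.single k 1).degree + 1 = d := by
        rw [← hmd]
        conv_rhs => rw [← hmk]
        simp
      have := hcoeff k (m - Finsupp.single k 1) (by omega)
      rw [coeff_pderiv, hmk] at this
      have hk1 : (m - Finsupp.single k 1 : Fin N →₀ ℕ) k + 1 = m k := by simp; omega
      rw [mul_eq_zero, or_iff_right hm] at this
      exact hk (by rw [← hk1, Nat.cast_succ, this])
    · exact absurd rfl hm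
  obtain ⟨b, hb⟩ : ∃ b : {j // j ∉ I} → MvPolynomial (Fin N) M,
      ∑ j, b j * (X j.1 - τ j.1) = G - p := by
    rw [← Ideal.mem_span_range_iff_exists_fun, ← Ideal.Quotient.eq]
    set J := Ideal.span (Set.range fun j : {j // j ∉ I} ↦ X (R := M) j.1 - τ j.1)
    have : (Ideal.Quotient.mkₐ M J).comp (aeval fun i ↦ C (a i) + X i) =
        (Ideal.Quotient.mkₐ M J).comp (aeval fun i ↦ C (a i) + τ i) := by
      ext i
      by_cases hi : i ∈ I
      · simp [hI i hi]
      · have : Ideal.Quotient.mk J (X i) = Ideal.Quotient.mk J (τ i) :=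
          Ideal.Quotient.eq.mpr (Ideal.subset_span ⟨⟨i, hi⟩, rfl⟩)
        simp [this]
    exact DFunLike.congr_fun this F
  have hb0 (j : {j // j ∉ I}) : constantCoeff (b j) = 0 := by
    have h₁ : constantCoeff (pderiv j.1 (G - p)) = 0 := by
      have (f : Fin N → MvPolynomial (Fin N) M) (hf : ∀ i, constantCoeff (f i) = 0) (i : Fin N) :
          constantCoeff (aeval (fun i ↦ C (a i) + f i) (pderiv i F)) = 0 := by
        have h₂ : constantCoeff (aeval (fun i ↦ C (a i) + τ i) (pderiv i F)) = 0 := by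
          rw [constantCoeff_eq]
          exact (mem_pow_idealOfVars_iff' _ _).mp (hP i) 0 (by simpa)
        have h₃ (g : Fin N → MvPolynomial (Fin N) M) (hg : ∀ i, constantCoeff (g i) = 0)
            (q : MvPolynomial (Fin N) M) :
            constantCoeff (aeval (fun i ↦ C (a i) + g i) q) = eval a q := by
          rw [aeval_def, hom_eval₂]
          congr 1
          · ext r; simp
          · ext i; simp [hg]
        rw [h₃ f hf, ← h₃ τ h0, h₂]
      rw [map_sub, map_sub, hG, hp, pderiv_aeval, pderiv_aeval, map_sum, map_sum]
      simp only [map_mul]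
      simp_rw [this X (by simp), this τ h0]
      simp
    rw [← hb, map_sum, map_sum, Finset.sum_eq_single j] at h₁
    · simpa [hv _ _ j.2, h0] using h₁
    · intro i _ hij
      have : j.1 ≠ i.1 := fun h ↦ hij (Subtype.ext h.symm)
      simp [hv _ _ j.2, h0, pderiv_X, this.symm]
    · simp
  have hFp : F = homogeneousComponent d p + ∑ j, homogeneousComponent d (b j * (X j.1 - τ j.1)) := by
    rw [← map_sum, hb, ← map_add, add_sub_cancel, hG, homogeneousComponent_translate a hF]
  have hsum : HasCollapse ((Finset.univ : Finset {j // j ∉ I}).card * (d - 1))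
      (∑ j, homogeneousComponent d (b j * (X j.1 - τ j.1))) := by
    refine HasCollapse.sum _ _ _ fun j _ ↦ ?_
    rw [homogeneousComponent_mul, Finset.Nat.sum_antidiagonal_eq_sum_range_succ_mk]
    have : ∑ k ∈ Finset.range d.succ, homogeneousComponent k (b j) *
        homogeneousComponent (d - k) (X j.1 - τ j.1) = ∑ k ∈ Finset.Ioo 0 d,
        homogeneousComponent k (b j) * homogeneousComponent (d - k) (X j.1 - τ j.1) := by
      refine (Finset.sum_subset (fun k hk ↦ ?_) fun k hk hk' ↦ ?_).symm
      · simp at hk ⊢; omega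
      · obtain rfl | rfl : k = 0 ∨ k = d := by simp at hk hk'; omega
        · rw [homogeneousComponent_zero, ← constantCoeff_eq, hb0, C_0, zero_mul]
        · rw [Nat.sub_self, homogeneousComponent_zero, ← constantCoeff_eq, map_sub,
            constantCoeff_X, h0, sub_zero, C_0, mul_zero]
    rw [this]
    have := HasCollapse.sum (Finset.Ioo 0 d) (fun k ↦ homogeneousComponent k (b j) *
        homogeneousComponent (d - k) (X j.1 - τ j.1)) 1 fun k hk ↦ by
      rw [Finset.mem_Ioo] at hk
      exact HasCollapse.mul hk.1 (Nat.sub_pos_of_lt hk.2) (homogeneousComponent_isHomogeneous _ _)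
        (homogeneousComponent_isHomogeneous _ _)
    simpa using this
  have hcard : (Finset.univ : Finset {j // j ∉ I}).card = N - I.card := by
    simp [Fintype.card_subtype_compl]
  rw [hcard] at hsum
  rw [hFp]
  exact hE.add hsum

namespace MvPolynomial

lemma le_height_ker_constantCoeff (K : Type*) [Field K] (N : ℕ) :
    (N : ℕ∞) ≤ (RingHom.ker (constantCoeff (R := K) (σ := Fin N))).height := by
  let φ (k : ℕ) : MvPolynomial (Fin N) K →ₐ[K] MvPolynomial (Fin N) K :=
    aeval fun i ↦ if i < k then 0 else X i
  have hφ (k : ℕ) (i : Fin N) : φ k (X i) = if i < k then 0 else X i := aeval_X _ _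
  have hle (k : ℕ) : RingHom.ker (φ k) ≤ RingHom.ker (φ (k + 1)) := fun p hp ↦ by
    have : φ (k + 1) = (φ (k + 1)).comp (φ k) := by
      ext i : 1
      rw [AlgHom.comp_apply, hφ, hφ k]
      split_ifs with h₁ h₂ h₂
      · rw [map_zero]
      · rw [hφ, if_pos h₁]
      · omega
      · rw [hφ, if_neg h₁]
    rw [RingHom.mem_ker] at hp ⊢
    rw [this, AlgHom.comp_apply, hp, map_zero]
  let l : LTSeries (PrimeSpectrum (MvPolynomial (Fin N) K)) :=
    { length := N
      toFun := fun k ↦ ⟨RingHom.ker (φ k), RingHom.ker_isPrime _⟩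
      step := fun k ↦ by
        change RingHom.ker (φ k) < RingHom.ker (φ (k + 1))
        refine (SetLike.lt_iff_le_and_exists).mpr ⟨hle k, X k, ?_, ?_⟩
        · simp [hφ]
        · simp [hφ] }
  have hprime : (RingHom.ker (constantCoeff (R := K) (σ := Fin N))).IsPrime :=
    RingHom.ker_isPrime _
  refine (Order.length_le_height (p := l) (x := ⟨_, hprime⟩) ?_).trans
    (PrimeSpectrum.height_eq_orderHeight _).ge
  change RingHom.ker (φ N) ≤ _
  have : constantCoeff = (constantCoeff (R := K) (σ := Fin N)).comp (φ N).toRingHom := by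
    ext i
    · simp
    · simp [hφ]
  intro p hp
  rw [RingHom.mem_ker] at hp ⊢
  rw [this]
  simp [hp]

/-- `h` elements of the irrelevant ideal of `K[x_1, …, x_N]` lie in a prime ideal whose quotient
contains `s ≥ N - h` algebraically independent elements. -/
lemma exists_isPrime_algebraicIndependent_quotient {K : Type*} [Field K] {N h : ℕ}
    (g : Fin h → MvPolynomial (Fin N) K) (hg : ∀ i, constantCoeff (g i) = 0) :
    ∃ P : Ideal (MvPolynomial (Fin N) K), P.IsPrime ∧ Ideal.span (Set.range g) ≤ P ∧
      ∃ s, N ≤ s + h ∧ ∃ x : Fin s → MvPolynomial (Fin N) K ⧸ P, AlgebraicIndependent K x := by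
  set J := Ideal.span (Set.range g)
  have hgs : Set.range g ⊆ RingHom.ker (constantCoeff (R := K) (σ := Fin N)) := by
    rintro _ ⟨i, rfl⟩
    exact hg i
  have : (RingHom.ker (constantCoeff (R := K) (σ := Fin N))).IsPrime := RingHom.ker_isPrime _
  have : Nontrivial (MvPolynomial (Fin N) K ⧸ J) :=
    Ideal.Quotient.nontrivial_iff.mpr fun hJ ↦ RingHom.ker_ne_top (constantCoeff (R := K))
      (top_le_iff.mp (hJ.symm.trans_le (Ideal.span_le.mpr hgs)))
  have hdim : (N : WithBot ℕ∞) ≤ ringKrullDim (MvPolynomial (Fin N) K ⧸ J) + h := by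
    have h₁ := Ideal.height_le_ringKrullDim_quotient_add_encard _ hgs
    have h₂ : (Set.range g).encard ≤ h := by
      rw [← Set.image_univ]
      exact (Set.encard_image_le _ _).trans (by simp)
    calc (N : WithBot ℕ∞) ≤ _ := mod_cast le_height_ker_constantCoeff K N
      _ ≤ _ := h₁
      _ ≤ _ := by gcongr; exact_mod_cast h₂
  obtain ⟨s, f, hf, hfi⟩ := exists_integral_inj_algHom_of_fg K (MvPolynomial (Fin N) K ⧸ J)
  algebraize [f.toRingHom]
  have hs : ringKrullDim (MvPolynomial (Fin N) K ⧸ J) ≤ s := by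
    have : ringKrullDim (MvPolynomial (Fin s) K) = s := by
      rw [ringKrullDim_of_isNoetherianRing, ringKrullDim_eq_zero_of_field]
      simp
    rw [← this]
    exact Order.krullDim_le_of_strictMono (PrimeSpectrum.comap f.toRingHom) fun P Q hPQ ↦
      Ideal.IsIntegral.comap_lt_comap (R := MvPolynomial (Fin s) K) hPQ
  obtain ⟨Q, -, hQ, hQ0⟩ := Ideal.exists_ideal_over_prime_of_isIntegral
    (⊥ : Ideal (MvPolynomial (Fin s) K)) (⊥ : Ideal (MvPolynomial (Fin N) K ⧸ J))
    (fun p hp ↦ hf (by rw [map_zero]; exact hp))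
  have hJP : J ≤ Q.comap (Ideal.Quotient.mk J) := fun p hp ↦ by
    rw [Ideal.mem_comap, Ideal.Quotient.eq_zero_iff_mem.mpr hp]
    exact Q.zero_mem
  refine ⟨Q.comap (Ideal.Quotient.mk J), inferInstance, hJP, s, ?_, ?_⟩
  · have := hdim.trans (by gcongr : _ ≤ (s : WithBot ℕ∞) + h)
    exact_mod_cast this
  · let π := Ideal.Quotient.factorₐ K hJP
    refine ⟨fun i ↦ π (f (X i)), ?_⟩
    have : (aeval fun i ↦ π (f (X i))) = π.comp f := by ext i; simp
    rw [AlgebraicIndependent, this, injective_iff_map_eq_zero]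
    intro p hp
    obtain ⟨r, hr⟩ := Ideal.Quotient.mk_surjective (f p)
    rw [AlgHom.comp_apply, ← hr, Ideal.Quotient.factorₐ_apply_mk,
      Ideal.Quotient.eq_zero_iff_mem, Ideal.mem_comap, hr] at hp
    have : p ∈ (⊥ : Ideal (MvPolynomial (Fin s) K)) := hQ0 ▸ hp
    exact this

end MvPolynomial

section SeparatingBasis

open IntermediateField

/-- Over a perfect field, every finite family of field generators contains a separating
transcendence basis. -/
lemma exists_isTranscendenceBasis_and_isSeparable_of_adjoin_eq_top {k L ι : Type*} [Field k]
    [Field L] [Algebra k L] [PerfectField k] [Finite ι] (a : ι → L)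
    (ha : adjoin k (Set.range a) = ⊤) :
    ∃ s : Set ι, IsTranscendenceBasis k (fun i : s ↦ a i) ∧
      Algebra.IsSeparable (adjoin k (a '' s)) L := by
  have hbasis : ∃ s : Set ι, IsTranscendenceBasis k (fun i : s ↦ a i) := by
    have : Algebra.IsAlgebraic (Algebra.adjoin k (Set.range a)) L := by
      rw [← isAlgebraic_adjoin_iff_top, ha, Algebra.isAlgebraic_iff_isIntegral]
      exact Algebra.isIntegral_of_surjective topEquiv.surjective
    obtain ⟨t, hts, ht⟩ := exists_isTranscendenceBasis_subset (R := k) (Set.range a)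
    obtain ⟨s, -, hs⟩ := Set.SurjOn.exists_bijOn_subset (f := a) (s := Set.univ) (t := t)
      (by rwa [Set.SurjOn, Set.image_univ])
    exact ⟨s, ht.comp_equiv (Set.BijOn.equiv a hs)⟩
  obtain _ | ⟨p, hp, hpk⟩ := CharP.exists' k
  · obtain ⟨s, hs⟩ := hbasis
    have : Algebra.IsAlgebraic (adjoin k (a '' s)) L := by
      convert! hs.isAlgebraic_field <;> simp [Set.image_eq_range]
    exact ⟨s, hs, inferInstance⟩
  have : ExpChar k p := .prime hp.out
  have : CharP L p := .of_ringHom_of_ne_zero (algebraMap k L) p hp.out.ne_zero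
  have H (s : Finset L) (hs : LinearIndepOn k _root_.id (s : Set L)) :
      LinearIndepOn k (· ^ p) (s : Set L) := by
    refine hs.map_of_injective_injective (frobeniusEquiv k p).symm
      (frobenius L p).toAddMonoidHom (by simp) (fun x hx ↦ ?_) fun r x ↦ ?_
    · exact frobenius_inj L p (hx.trans (map_zero _).symm)
    · change ((frobeniusEquiv k p).symm r • x) ^ p = r • x ^ p
      rw [smul_pow, frobeniusEquiv_symm_pow_p]
  obtain ⟨s, hs, Hs⟩ := Set.Finite.exists_maximalFor
    (fun s : Set ι ↦ (separableClosure (adjoin k (a '' s)) L).restrictScalars k)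
    {s | IsTranscendenceBasis k (fun i : s ↦ a i)} (Set.toFinite _) hbasis
  refine ⟨s, hs, ?_⟩
  rw [← separableClosure.eq_top_iff, ← (restrictScalars_injective k).eq_iff,
    restrictScalars_top, eq_top_iff, ← ha, adjoin_le_iff]
  rintro _ ⟨n, rfl⟩
  by_contra hn
  have hns : n ∉ s := fun h ↦
    hn (le_restrictScalars_separableClosure _ (subset_adjoin _ _ ⟨n, h, rfl⟩))
  obtain ⟨i, hi₁, hi₂⟩ := exists_isTranscendenceBasis_and_isSeparable_of_linearIndepOn_pow'
    p hp.out (a := a) H s n hs hns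
  refine not_lt_iff_le_imp_ge.mpr (Hs hi₁) (SetLike.lt_iff_le_and_exists.mpr ⟨?_, a n, ?_, hn⟩)
  · rw [separableClosure_le_separableClosure_iff, adjoin_le_iff]
    rintro _ ⟨x, hx, rfl⟩
    obtain rfl | ne := eq_or_ne x i
    exacts [hi₂, le_restrictScalars_separableClosure _
      (subset_adjoin _ _ ⟨x, ⟨.inr hx, ne⟩, rfl⟩)]
  · obtain rfl | ne := eq_or_ne n i
    exacts [hi₂, le_restrictScalars_separableClosure _
      (subset_adjoin _ _ ⟨n, ⟨.inl rfl, ne⟩, rfl⟩)]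

end SeparatingBasis

section Lifting

namespace MvPolynomial

lemma mem_idealOfVars_iff_constantCoeff {σ R : Type*} [CommRing R] (p : MvPolynomial σ R) :
    p ∈ idealOfVars σ R ↔ constantCoeff p = 0 := by
  rw [← pow_one (idealOfVars σ R), mem_pow_idealOfVars_iff' 1 p, constantCoeff_eq]
  simp [Finsupp.degree_eq_zero_iff]

end MvPolynomial

variable {K L M ι : Type*} [Field K] [Field L] [Field M] [Algebra K L] [Algebra L M]
  [Algebra K M] [IsScalarTower K L M]

open scoped IntermediateField.algebraAdjoinAdjoin in
lemma formallySmooth_adjoin_of_isSeparable {v : ι → L}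
    [Algebra.IsSeparable (IntermediateField.adjoin K (Set.range v)) L] :
    Algebra.FormallySmooth (Algebra.adjoin K (Set.range v)) L := by
  have : Algebra.FormallySmooth (Algebra.adjoin K (Set.range v))
      (IntermediateField.adjoin K (Set.range v)) :=
    .of_isLocalization (nonZeroDivisors _)
  have : Algebra.FormallyEtale (IntermediateField.adjoin K (Set.range v)) L :=
    Algebra.FormallyEtale.of_isSeparable _ L
  exact .comp _ (IntermediateField.adjoin K (Set.range v)) _

/-- Lifting along a nilpotent surjection from a field `L` separable over `K(v)`, with `v`
algebraically independent: the images of the `v i` can be prescribed. -/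
lemma exists_algHom_lift_of_isSeparable {T : Type*} [CommRing T] [Algebra K T] {v : ι → L}
    (hv : AlgebraicIndependent K v)
    [Algebra.IsSeparable (IntermediateField.adjoin K (Set.range v)) L] (γ : T →ₐ[K] M)
    (hγ : Function.Surjective γ) (hnil : IsNilpotent (RingHom.ker γ)) (w : ι → T)
    (hw : ∀ i, γ (w i) = algebraMap L M (v i)) :
    ∃ Ψ : L →ₐ[K] T, (∀ i, Ψ (v i) = w i) ∧ ∀ x, γ (Ψ x) = algebraMap L M x := by
  let A := Algebra.adjoin K (Set.range v)
  have : Algebra.FormallySmooth A L := formallySmooth_adjoin_of_isSeparable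
  let β : A →ₐ[K] T := (aeval w).comp hv.aevalEquiv.symm.toAlgHom
  let : Algebra A T := β.toAlgebra
  have : IsScalarTower K A T := .of_algebraMap_eq fun c ↦ (β.commutes c).symm
  have hγβ : γ.comp β = IsScalarTower.toAlgHom K A M := by
    have : (γ.comp (aeval w)) = (IsScalarTower.toAlgHom K A M).comp hv.aevalEquiv.toAlgHom := by
      ext i
      simp [hw, IsScalarTower.algebraMap_apply A L M]
    ext x
    obtain ⟨p, rfl⟩ := hv.aevalEquiv.surjective x
    simpa [β] using DFunLike.congr_fun this p
  let γ' : T →ₐ[A] M := { γ.toRingHom with commutes' := fun x ↦ DFunLike.congr_fun hγβ x }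
  let Ψ := Algebra.FormallySmooth.liftOfSurjective (IsScalarTower.toAlgHom A L M) γ' hγ hnil
  refine ⟨Ψ.restrictScalars K, fun i ↦ ?_, fun x ↦ ?_⟩
  · have h₁ := Ψ.commutes (hv.aevalEquiv (X i))
    have h₂ : algebraMap A L (hv.aevalEquiv (X i)) = v i := by simp
    have h₃ : algebraMap A T (hv.aevalEquiv (X i)) = w i := by
      change β _ = _
      simp [β]
    rwa [h₂, h₃] at h₁
  · exact Algebra.FormallySmooth.liftOfSurjective_apply _ γ' hγ hnil x

/-- If `L` is separable over `K(v)` with `v` algebraically independent, then `L` maps to the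
truncated polynomial ring in variables `X_i`, with `v_i` going to `v_i + X_i`. -/
lemma exists_algHom_truncated {v : ι → L} (hv : AlgebraicIndependent K v)
    [Algebra.IsSeparable (IntermediateField.adjoin K (Set.range v)) L] {d : ℕ} (hd : d ≠ 0) :
    ∃ Ψ : L →ₐ[K] MvPolynomial ι M ⧸ idealOfVars ι M ^ d,
      (∀ i, Ψ (v i) = Ideal.Quotient.mk _ (C (algebraMap L M (v i)) + X i)) ∧
      ∀ x, ∃ t, constantCoeff t = 0 ∧ Ψ x = Ideal.Quotient.mk _ (C (algebraMap L M x) + t) := by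
  let ε : MvPolynomial ι M →ₐ[K] M := (aeval (fun _ ↦ 0) : MvPolynomial ι M →ₐ[M] M).restrictScalars K
  have hε (p : MvPolynomial ι M) : ε p = constantCoeff p := by simp [ε, constantCoeff_eq]
  let γ : MvPolynomial ι M ⧸ idealOfVars ι M ^ d →ₐ[K] M :=
    Ideal.Quotient.liftₐ _ ε fun p hp ↦ by
      rw [hε]
      exact (mem_idealOfVars_iff_constantCoeff p).mp (Ideal.pow_le_self hd hp)
  have hγ (p : MvPolynomial ι M) : γ (Ideal.Quotient.mk _ p) = constantCoeff p := hε p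
  have hnil : IsNilpotent (RingHom.ker γ) := by
    refine ⟨d, ?_⟩
    have : RingHom.ker γ ≤ (idealOfVars ι M).map (Ideal.Quotient.mk (idealOfVars ι M ^ d)) := by
      intro x hx
      obtain ⟨p, rfl⟩ := Ideal.Quotient.mk_surjective x
      rw [RingHom.mem_ker, hγ, ← mem_idealOfVars_iff_constantCoeff] at hx
      exact Ideal.mem_map_of_mem _ hx
    refine le_bot_iff.mp ?_
    refine (Ideal.pow_right_mono this d).trans ?_
    rw [← Ideal.map_pow, Ideal.map_quotient_self]
  obtain ⟨Ψ, h₁, h₂⟩ := exists_algHom_lift_of_isSeparable hv γ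
    (fun x ↦ ⟨Ideal.Quotient.mk _ (C x), by rw [hγ, constantCoeff_C]⟩) hnil
    (fun i ↦ Ideal.Quotient.mk _ (C (algebraMap L M (v i)) + X i)) (fun i ↦ by simp [hγ])
  refine ⟨Ψ, h₁, fun x ↦ ?_⟩
  obtain ⟨p, hp⟩ := Ideal.Quotient.mk_surjective (Ψ x)
  refine ⟨p - C (algebraMap L M x), ?_, by rw [add_sub_cancel, hp]⟩
  rw [map_sub, constantCoeff_C, ← hγ, hp, h₂, sub_self]

end Lifting

/-- Collapses descend along extensions of an algebraically closed field. -/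
lemma HasCollapse.of_map_algebraMap {K M : Type*} [Field K] [IsAlgClosed K] [Field M] [Algebra K M]
    {N k : ℕ} {F : MvPolynomial (Fin N) K} (hF : HasCollapse k (map (algebraMap K M) F)) :
    HasCollapse k F := by
  classical
  obtain ⟨f, g, hf, hg, hfg⟩ := hF
  let S : Finset M := Finset.univ.biUnion fun i ↦ (f i).coeffs ∪ (g i).coeffs
  let A := Algebra.adjoin K (S : Set M)
  have : Algebra.FiniteType K A :=
    A.fg_iff_finiteType.mp (Subalgebra.fg_adjoin_finset S)
  obtain ⟨φ⟩ : Nonempty (A →ₐ[K] K) := by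
    obtain ⟨m, hm⟩ := Ideal.exists_maximal A
    let := Ideal.Quotient.field m
    have := finite_of_finite_type_of_isJacobsonRing K (A ⧸ m)
    exact ⟨(AlgEquiv.ofBijective (Algebra.ofId K (A ⧸ m))
      IsAlgClosed.algebraMap_bijective_of_isIntegral).symm.toAlgHom.comp (Ideal.Quotient.mkₐ K m)⟩
  have hinj : Function.Injective (algebraMap A M) := Subtype.val_injective
  have hlift (p : MvPolynomial (Fin N) M) (hp : p.coeffs ⊆ S) :
      ∃ q : MvPolynomial (Fin N) A, map (algebraMap A M) q = p := by
    refine mem_range_map_iff_coeffs_subset.mpr fun c hc ↦ ⟨⟨c, Algebra.subset_adjoin ?_⟩, rfl⟩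
    exact hp hc
  choose f' hf' using fun i ↦ hlift (f i) fun c hc ↦
    Finset.mem_biUnion.mpr ⟨i, Finset.mem_univ i, Finset.mem_union_left _ hc⟩
  choose g' hg' using fun i ↦ hlift (g i) fun c hc ↦
    Finset.mem_biUnion.mpr ⟨i, Finset.mem_univ i, Finset.mem_union_right _ hc⟩
  refine ⟨fun i ↦ map φ.toRingHom (f' i), fun i ↦ map φ.toRingHom (g' i), fun i ↦ ?_, fun i ↦ ?_, ?_⟩
  · obtain ⟨e, he, hfe⟩ := hf i
    exact ⟨e, he, ((hf' i ▸ hfe).of_map hinj).map _⟩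
  · obtain ⟨e, he, hge⟩ := hg i
    exact ⟨e, he, ((hg' i ▸ hge).of_map hinj).map _⟩
  · have hA : map (algebraMap K A) F = ∑ i, f' i * g' i := by
      apply map_injective _ hinj
      rw [map_map, ← IsScalarTower.algebraMap_eq, hfg, map_sum]
      simp_rw [map_mul, hf', hg']
    have hφ : φ.toRingHom.comp (algebraMap K A) = RingHom.id K := RingHom.ext φ.commutes
    calc F = map φ.toRingHom (map (algebraMap K A) F) := by rw [map_map, hφ, map_id]
      _ = _ := by simp [hA]

lemma adjoin_range_algebraMap_fractionRing_eq_top {K ι : Type*} [Field K]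
    (P : Ideal (MvPolynomial ι K)) [P.IsPrime] :
    IntermediateField.adjoin K (Set.range fun i ↦
      algebraMap (MvPolynomial ι K ⧸ P) (FractionRing (MvPolynomial ι K ⧸ P))
        (Ideal.Quotient.mk P (X i))) = ⊤ := by
  set a := fun i ↦ algebraMap (MvPolynomial ι K ⧸ P) (FractionRing (MvPolynomial ι K ⧸ P))
        (Ideal.Quotient.mk P (X i))
  have hmem (q : MvPolynomial ι K ⧸ P) :
      algebraMap _ (FractionRing (MvPolynomial ι K ⧸ P)) q ∈
        IntermediateField.adjoin K (Set.range a) := by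
    obtain ⟨q, rfl⟩ := Ideal.Quotient.mk_surjective q
    induction q using MvPolynomial.induction_on with
    | C r => exact (IntermediateField.adjoin K (Set.range a)).algebraMap_mem r
    | add p q hp hq => rw [map_add, map_add]; exact add_mem hp hq
    | mul_X p i hp =>
      rw [map_mul, map_mul]
      exact mul_mem hp (IntermediateField.subset_adjoin _ _ ⟨i, rfl⟩)
  rw [eq_top_iff]
  rintro x -
  obtain ⟨p, q, -, rfl⟩ := IsFractionRing.div_surjective (A := MvPolynomial ι K ⧸ P) x
  exact div_mem (hmem p) (hmem q)

/-- A form of degree `d` whose partial derivatives lie in an ideal generated by `h` polynomials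
without constant term has a collapse of length `1 + h (d - 1)`. -/
theorem hasCollapse_of_pderiv_mem_span {K : Type*} [Field K] [IsAlgClosed K] {N d h : ℕ}
    (hd : 0 < d) {F : MvPolynomial (Fin N) K} (hF : F.IsHomogeneous d)
    (g : Fin h → MvPolynomial (Fin N) K) (hg : ∀ i, constantCoeff (g i) = 0)
    (hFg : ∀ j, pderiv j F ∈ Ideal.span (Set.range g)) :
    HasCollapse (1 + h * (d - 1)) F := by
  classical
  obtain ⟨P, hP, hgP, n, hn, x, hx⟩ := exists_isPrime_algebraicIndependent_quotient g hg
  let L := FractionRing (MvPolynomial (Fin N) K ⧸ P)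
  let M := AlgebraicClosure L
  let a (i : Fin N) : L := algebraMap (MvPolynomial (Fin N) K ⧸ P) L (Ideal.Quotient.mk P (X i))
  obtain ⟨s, hs, hsep⟩ := exists_isTranscendenceBasis_and_isSeparable_of_adjoin_eq_top a
    (adjoin_range_algebraMap_fractionRing_eq_top P)
  have hcard : N - s.toFinset.card ≤ h := by
    have h₁ := (hx.map' (f := IsScalarTower.toAlgHom K (MvPolynomial (Fin N) K ⧸ P) L)
      (IsFractionRing.injective _ L)).lift_cardinalMk_le_trdeg
    rw [← hs.lift_cardinalMk_eq_trdeg] at h₁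
    simp only [Cardinal.lift_natCast, Cardinal.mk_fintype, Nat.cast_le, Fintype.card_fin] at h₁
    rw [Set.toFinset_card]
    omega
  have haP (q : MvPolynomial (Fin N) K) (hq : q ∈ P) : aeval a q = 0 := by
    have : aeval a = (IsScalarTower.toAlgHom K (MvPolynomial (Fin N) K ⧸ P) L).comp
        (Ideal.Quotient.mkₐ K P) := by ext i; simp [a]
    rw [this, AlgHom.comp_apply, Ideal.Quotient.mkₐ_eq_mk, Ideal.Quotient.eq_zero_iff_mem.mpr hq,
      map_zero]
  rw [Set.image_eq_range] at hsep
  obtain ⟨Ψ, hΨ, hΨ'⟩ := exists_algHom_truncated (M := M) hs.1 hd.ne'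
  choose t ht0 ht using hΨ'
  let τ (i : Fin N) : MvPolynomial s M := if hi : i ∈ s then X ⟨i, hi⟩ else t (a i)
  have hτ0 (i : Fin N) : constantCoeff (τ i) = 0 := by
    simp only [τ]
    split_ifs
    · simp
    · exact ht0 _
  have hτ (q : MvPolynomial (Fin N) K) :
      Ψ (aeval a q) = Ideal.Quotient.mk _ (aeval (fun i ↦ C (algebraMap L M (a i)) + τ i) q) := by
    have : Ψ.comp (aeval a) = (Ideal.Quotient.mkₐ K (idealOfVars s M ^ d)).comp
        (aeval fun i ↦ C (algebraMap L M (a i)) + τ i) := by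
      ext i
      simp only [AlgHom.comp_apply, aeval_X, τ]
      split_ifs with hi
      · exact hΨ ⟨i, hi⟩
      · exact ht (a i)
    exact DFunLike.congr_fun this q
  refine (HasCollapse.of_map_algebraMap (M := M) ?_).mono
    (by gcongr : 1 + (N - s.toFinset.card) * (d - 1) ≤ _)
  refine hasCollapse_of_aeval_pderiv_mem hd _ (hF.map _) (fun i ↦ algebraMap L M (a i))
    (fun i ↦ rename Subtype.val (τ i)) (fun i ↦ ?_) (fun i hi ↦ ?_) (fun i k hk ↦ ?_) fun j ↦ ?_
  · rw [constantCoeff_rename, hτ0]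
  · rw [Set.mem_toFinset] at hi
    simp [τ, hi]
  · refine pderiv_eq_zero_of_notMem_vars fun hk' ↦ hk ?_
    obtain ⟨l, -, rfl⟩ := Finset.mem_image.mp (vars_rename _ _ hk')
    simp
  · rw [pderiv_map, aeval_map_algebraMap]
    have h₁ : aeval (fun i ↦ C (algebraMap L M (a i)) + τ i) (pderiv j F) ∈ idealOfVars s M ^ d := by
      rw [← Ideal.Quotient.eq_zero_iff_mem, ← hτ, haP _ (hgP (hFg j)), map_zero]
    have h₂ : aeval (fun i ↦ C (algebraMap L M (a i)) + rename Subtype.val (τ i)) (pderiv j F) =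
        rename Subtype.val (aeval (fun i ↦ C (algebraMap L M (a i)) + τ i) (pderiv j F)) := by
      rw [← AlgHom.restrictScalars_apply K (rename (R := M) (Subtype.val : s → Fin N)),
        ← AlgHom.comp_apply]
      congr 1
      ext i
      simp
    have h₃ : (idealOfVars s M).map (rename (R := M) (Subtype.val : s → Fin N)) ≤
        idealOfVars (Fin N) M := by
      refine Ideal.map_le_iff_le_comap.mpr fun p hp ↦ ?_
      rw [mem_idealOfVars_iff_constantCoeff] at hp
      rw [Ideal.mem_comap, mem_idealOfVars_iff_constantCoeff, constantCoeff_rename, hp]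
    rw [h₂]
    refine Ideal.pow_right_mono h₃ d ?_
    rw [← Ideal.map_pow]
    exact Ideal.mem_map_of_mem _ h₁

/-- With `Φ_2(h) = h + 2` and `Φ_d(h) = d ↑^(d²-d-2) (d^(max{2,h}))` for `d ≥ 3`:
if `F` is a form of degree `d` with strength at least `Φ_d(h)`, then the ideal of
partial derivatives of `F` is not contained in any ideal generated by `h` forms of
degrees at most `d-1`. -/
theorem derivative_ideal_not_contained {K : Type*} [Field K] [IsAlgClosed K] {N : ℕ}
    (d h : ℕ) (hd : 2 ≤ d) (hh : 1 ≤ h)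
    (F : MvPolynomial (Fin N) K) (hhom : F.IsHomogeneous d)
    (hstr : ¬ HasCollapse
      (if d = 2 then h + 2 else knuth d (d ^ 2 - d - 2) (d ^ max 2 h)) F)
    (g : Fin h → MvPolynomial (Fin N) K)
    (hg : ∀ i, ∃ e : ℕ, 0 < e ∧ e ≤ d - 1 ∧ (g i).IsHomogeneous e) :
    ¬ (Ideal.span (Set.range fun i : Fin N => MvPolynomial.pderiv i F) ≤
        Ideal.span (Set.range g)) := by
  intro hle
  have hF := hasCollapse_of_pderiv_mem_span (by omega) hhom g (fun i ↦ ?_)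
    fun j ↦ hle (Ideal.subset_span ⟨j, rfl⟩)
  · refine hstr (hF.mono ?_)
    split_ifs with hd2
    · subst hd2; omega
    · rw [mul_comm]
      exact (one_add_mul_le_pow_max hd h).trans (lt_knuth hd _ _).le
  · obtain ⟨e, he, -, hge⟩ := hg i
    rw [constantCoeff_eq]
    exact hge.coeff_eq_zero (by simpa using he.ne)
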